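/- arXiv:2304.11623 — 4 statements merged into one kernel-verified Lean document; each statement's English description precedes it below -/
import Mathlib

section
/- Let P, t̄, η̂, α, K be natural numbers with η̂ ≥ 1, Q = t̄ + 1 ≤ P, and K = P·η̂, and let γ = t̄/P as a rational number. Then, as rational numbers, (K · C(P−1, Q−1) · α) / (η̂ · ∑_{r=1}^{P−Q+1} C(P−r, Q−1)) = α · (P·γ + 1) = α · (t̄ + 1). -/
/-- The hockey-stick identity, summed downwards from the largest upper index. -/
theorem sum_Icc_choose_sub (n k : ℕ) (h : k + 1 ≤ n) :
    ∑ r ∈ Finset.Icc 1 (n - k), (n - r).choose k = n.choose (k + 1) := by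
  obtain ⟨m, rfl⟩ : ∃ m, n = m + 1 := ⟨n - 1, by lia⟩
  rw [← Nat.sum_Icc_choose]
  refine Finset.sum_nbij' (m + 1 - ·) (m + 1 - ·) ?_ ?_ ?_ ?_ ?_ <;>
    simp only [Finset.mem_Icc] <;> intros <;> first | rfl | lia

/-- Remark 2, case 1 (α ≤ η̂, uniform association): the DoF expression simplifies to
α·(P·γ + 1) = α·(t̄ + 1), with γ = t̄/P. -/
theorem dof_uniform_alpha_le_eta (P tbar etahat α K Q : ℕ)
    (hη : 1 ≤ etahat) (hQ : Q = tbar + 1) (hQP : Q ≤ P) (hK : K = P * etahat)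
    (γ : ℚ) (hγ : γ = (tbar : ℚ) / (P : ℚ)) :
    ((K : ℚ) * (Nat.choose (P - 1) (Q - 1) : ℚ) * (α : ℚ)) /
        ((etahat : ℚ) * ∑ r ∈ Finset.Icc 1 (P - Q + 1), (Nat.choose (P - r) (Q - 1) : ℚ))
      = (α : ℚ) * ((P : ℚ) * γ + 1)
    ∧ (α : ℚ) * ((P : ℚ) * γ + 1) = (α : ℚ) * ((tbar : ℚ) + 1) := by
  subst hQ hK hγ
  have hP : (P : ℚ) ≠ 0 := by
    have : P ≠ 0 := by lia
    exact_mod_cast this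
  have hη0 : (etahat : ℚ) ≠ 0 := by
    have : etahat ≠ 0 := by lia
    exact_mod_cast this
  have hγ : (P : ℚ) * ((tbar : ℚ) / P) = tbar := mul_div_cancel₀ _ hP
  have hsum : ∑ r ∈ Finset.Icc 1 (P - (tbar + 1) + 1), ((P - r).choose tbar : ℚ)
      = P.choose (tbar + 1) := by
    rw [show P - (tbar + 1) + 1 = P - tbar by lia]
    exact_mod_cast sum_Icc_choose_sub P tbar hQP
  have hchoose : (P.choose (tbar + 1) : ℚ) ≠ 0 := by
    exact_mod_cast (Nat.choose_pos hQP).ne'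
  have habsorb : (P : ℚ) * (P - 1).choose tbar = P.choose (tbar + 1) * (tbar + 1) := by
    have := Nat.add_one_mul_choose_eq (P - 1) tbar
    rw [Nat.sub_add_cancel (by lia)] at this
    exact_mod_cast this
  rw [hγ, Nat.add_sub_cancel, hsum]
  refine ⟨?_, rfl⟩
  rw [div_eq_iff (mul_ne_zero hη0 hchoose)]
  push_cast
  linear_combination (etahat : ℚ) * α * habsorb
end

section
/- Let P, t̄, η̂, α, ν₂, K be natural numbers with 2 ≤ Q ≤ P, η̂ ≥ 1, ν₂ ≥ 1, and K = P·η̂, and let γ = t̄/P as a rational number. Then, as rational numbers, (K · C(P−1, Q−1) · (η̂·t̄ + α) · ν₂) / (∑_{r=1}^{P} ∑_{c=1}^{P−Q+1} ∑_{m=1}^{η̂} ∑_{s=1}^{ν₂} C(P−c−1, Q−2)) = K·γ + α. -/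
/-- The hockey-stick identity, with the upper index running downwards. -/
theorem sum_Icc_choose_sub_sub_one {P Q : ℕ} (hQ : 2 ≤ Q) (hQP : Q ≤ P) :
    ∑ c ∈ Finset.Icc 1 (P - Q + 1), (P - c - 1).choose (Q - 2) = (P - 1).choose (Q - 1) := by
  have h := Nat.sum_Icc_choose (P - 2) (Q - 2)
  rw [show P - 2 + 1 = P - 1 by omega, show Q - 2 + 1 = Q - 1 by omega] at h
  rw [← h]
  refine Finset.sum_nbij' (fun c => P - c - 1) (fun m => P - m - 1) ?_ ?_ ?_ ?_ ?_ <;>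
    intro c hc <;> simp only [Finset.mem_Icc] at hc ⊢ <;> omega

/-- Remark 2, case 3 (Strategy B, uniform association): the achievable DoF equals
the optimal K·γ + α, with γ = t̄/P and K = P·η̂. -/
theorem dof_uniform_strategyB (P tbar etahat α ν₂ K Q : ℕ)
    (hQ : 2 ≤ Q) (hQP : Q ≤ P) (hη : 1 ≤ etahat) (hν : 1 ≤ ν₂) (hK : K = P * etahat)
    (γ : ℚ) (hγ : γ = (tbar : ℚ) / (P : ℚ)) :
    ((K : ℚ) * (Nat.choose (P - 1) (Q - 1) : ℚ) * ((etahat : ℚ) * (tbar : ℚ) + (α : ℚ)) * (ν₂ : ℚ)) /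
        (∑ r ∈ Finset.Icc 1 P, ∑ c ∈ Finset.Icc 1 (P - Q + 1), ∑ m ∈ Finset.Icc 1 etahat,
          ∑ s ∈ Finset.Icc 1 ν₂, (Nat.choose (P - c - 1) (Q - 2) : ℚ))
      = (K : ℚ) * γ + (α : ℚ) := by
  have hsum : ∑ c ∈ Finset.Icc 1 (P - Q + 1), ((P - c - 1).choose (Q - 2) : ℚ)
      = ((P - 1).choose (Q - 1) : ℚ) := mod_cast sum_Icc_choose_sub_sub_one hQ hQP
  have hP : (P : ℚ) ≠ 0 := by
    norm_cast
    omega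
  have hη' : (etahat : ℚ) ≠ 0 := by
    norm_cast
    omega
  have hν' : (ν₂ : ℚ) ≠ 0 := by
    norm_cast
    omega
  have hC : ((P - 1).choose (Q - 1) : ℚ) ≠ 0 :=
    mod_cast (Nat.choose_pos (by omega : Q - 1 ≤ P - 1)).ne'
  simp only [Finset.sum_const, Nat.card_Icc, Nat.add_sub_cancel, nsmul_eq_mul,
    ← Finset.mul_sum, hsum]
  subst hK hγ
  push_cast
  field_simp
end

section
/- Let P, t̄, η̂, α, K be natural numbers with 1 ≤ η̂ ≤ α, η̂ dividing α, Q = t̄ + α/η̂ ≤ P, and P ≥ 1, and set γ = t̄/P and η_avg = K/P as rational numbers. Then, as rational numbers, (K · C(P−1, Q−1) · η̂) / (η̂ · C(P, Q)) = (K·γ + α) − α·(1 − η_avg/η̂). -/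
theorem choose_pred_div_choose {n k : ℕ} (hk : 1 ≤ k) (hkn : k ≤ n) :
    (Nat.choose (n - 1) (k - 1) : ℚ) / (Nat.choose n k : ℚ) = (k : ℚ) / (n : ℚ) := by
  obtain ⟨k, rfl⟩ := Nat.exists_eq_add_of_le' hk
  obtain ⟨n, rfl⟩ := Nat.exists_eq_add_of_le' (hk.trans hkn)
  have hc : (Nat.choose (n + 1) (k + 1) : ℚ) ≠ 0 :=
    Nat.cast_ne_zero.mpr (Nat.choose_pos hkn).ne'
  have hn : ((n + 1 : ℕ) : ℚ) ≠ 0 := Nat.cast_ne_zero.mpr n.succ_ne_zero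
  rw [Nat.add_sub_cancel, Nat.add_sub_cancel, div_eq_div_iff hc hn, mul_comm,
    mul_comm ((k + 1 : ℕ) : ℚ)]
  exact_mod_cast Nat.add_one_mul_choose_eq n k

/-- DoF-loss claim: for η̂ ∣ α, Q = t̄ + α/η̂ ≤ P, the DoF of Strategy A with β = η̂ equals
(K·γ + α) − α·(1 − η_avg/η̂), where γ = t̄/P and η_avg = K/P. -/
theorem dof_loss (P tbar etahat α K Q : ℕ)
    (hη : 1 ≤ etahat) (hηα : etahat ≤ α) (hdvd : etahat ∣ α)
    (hQ : Q = tbar + α / etahat) (hQP : Q ≤ P) (hP : 1 ≤ P)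
    (γ ηavg : ℚ) (hγ : γ = (tbar : ℚ) / (P : ℚ)) (hηavg : ηavg = (K : ℚ) / (P : ℚ)) :
    ((K : ℚ) * (Nat.choose (P - 1) (Q - 1) : ℚ) * (etahat : ℚ)) /
        ((etahat : ℚ) * (Nat.choose P Q : ℚ))
      = ((K : ℚ) * γ + (α : ℚ)) - (α : ℚ) * (1 - ηavg / (etahat : ℚ)) := by
  obtain ⟨m, rfl⟩ := hdvd
  rw [Nat.mul_div_cancel_left m hη] at hQ
  have hm : 1 ≤ m := Nat.pos_of_ne_zero fun h => by simp [h] at hηα; omega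
  have key := choose_pred_div_choose (hm.trans (by omega) : 1 ≤ Q) hQP
  have hη0 : (etahat : ℚ) ≠ 0 := by positivity
  have hP0 : (P : ℚ) ≠ 0 := by positivity
  calc _ = (K : ℚ) * ((Nat.choose (P - 1) (Q - 1) : ℚ) / (Nat.choose P Q : ℚ)) := by
        rw [mul_comm (etahat : ℚ), mul_div_mul_right _ _ hη0, mul_div_assoc]
    _ = _ := by
        rw [key, hγ, hηavg, hQ]
        push_cast
        field_simp
        ring
end

section
/- Let P, Q, t̄, η̂, α be natural numbers with t̄ + 2 ≤ Q ≤ P and P ≥ 1, and set γ = t̄/P as a rational number. Then, as rational numbers, C(P−1, Q−1) · C(Q−2, Q−t̄−2) · C(Q−1, Q−t̄−1) · (η̂·t̄ + α) = (1 − γ) · C(P, t̄) · C(P−t̄−1, Q−t̄−1) · C(Q−2, Q−t̄−2) · (η̂·t̄ + α). -/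
/-- Appendix D decodability identity for Strategy B: with γ = t̄/P and t̄ + 2 ≤ Q ≤ P,
C(P−1,Q−1)·C(Q−2,Q−t̄−2)·C(Q−1,Q−t̄−1)·(η̂·t̄+α)
  = (1−γ)·C(P,t̄)·C(P−t̄−1,Q−t̄−1)·C(Q−2,Q−t̄−2)·(η̂·t̄+α). -/
theorem strategyB_decodability (P Q tbar etahat α : ℕ)
    (h1 : tbar + 2 ≤ Q) (h2 : Q ≤ P) (hP : 1 ≤ P)
    (γ : ℚ) (hγ : γ = (tbar : ℚ) / (P : ℚ)) :
    (Nat.choose (P - 1) (Q - 1) : ℚ) * (Nat.choose (Q - 2) (Q - tbar - 2) : ℚ) *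
        (Nat.choose (Q - 1) (Q - tbar - 1) : ℚ) * ((etahat : ℚ) * (tbar : ℚ) + (α : ℚ))
      = (1 - γ) * (Nat.choose P tbar : ℚ) * (Nat.choose (P - tbar - 1) (Q - tbar - 1) : ℚ) *
        (Nat.choose (Q - 2) (Q - tbar - 2) : ℚ) * ((etahat : ℚ) * (tbar : ℚ) + (α : ℚ)) := by
  have hP0 : (P : ℚ) ≠ 0 := by exact_mod_cast (by omega : P ≠ 0)
  have h_uncached : (1 - γ) * (P.choose tbar : ℚ) = ((P - 1).choose tbar : ℚ) := by
    rw [hγ, one_sub_div hP0, div_mul_eq_mul_div, div_eq_iff hP0]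
    have h := Nat.choose_mul_succ_eq (P - 1) tbar
    rw [Nat.sub_add_cancel hP] at h
    rw [← Nat.cast_sub (by omega : tbar ≤ P), mul_comm]
    exact_mod_cast h.symm
  have h_trinomial : ((P - 1).choose (Q - 1) : ℚ) * ((Q - 1).choose (Q - tbar - 1) : ℚ) =
      ((P - 1).choose tbar : ℚ) * ((P - tbar - 1).choose (Q - tbar - 1) : ℚ) := by
    have h := Nat.choose_mul (n := P - 1) (k := Q - 1) (s := tbar) (by omega)
    rw [← Nat.choose_symm (by omega : tbar ≤ Q - 1), Nat.sub_right_comm Q,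
      Nat.sub_right_comm P] at h
    exact_mod_cast h
  rw [h_uncached, mul_right_comm (Nat.choose (P - 1) (Q - 1) : ℚ), h_trinomial]
end
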